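/- arXiv:1709.06808 — 8 statements merged into one kernel-verified Lean document; each statement's English description precedes it below -/
import Mathlib

section
/- Let k ≥ 3, let V be a type, let A : ZMod k → Option V be any state, and let (i_P, v_P), (i_Q, v_Q) be two WRN operations with i_P ≠ i_Q in ZMod k. Then the final states of the two interleavings coincide: Function.update (Function.update A i_P (some v_P)) i_Q (some v_Q) = Function.update (Function.update A i_Q (some v_Q)) i_P (some v_P); and moreover at least one of the following holds: (a) the response of WRN(i_P, v_P) is the same in both interleavings, i.e. (Function.update A i_P (some v_P)) (i_P + 1) = (Function.update (Function.update A i_Q (some v_Q)) i_P (some v_P)) (i_P + 1); or (b) the response of WRN(i_Q, v_Q) is the same in both interleavings, i.e. (Function.update A i_Q (some v_Q)) (i_Q + 1) = (Function.update (Function.update A i_P (some v_P)) i_Q (some v_Q)) (i_Q + 1). (This is the key step showing that when k ≥ 3, two WRN operations on distinct indices of a WRN_k object cannot resolve 2-process consensus from a critical configuration: one of the two processes cannot distinguish the two orderings.) -/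
/-- For `k ≥ 3`, two `WRN` operations on distinct indices commute as far as the
state is concerned, and at least one of the two processes receives the same
response in both interleavings. -/
theorem wrn_one_process_cannot_distinguish (k : ℕ) (hk : 3 ≤ k) (V : Type*)
    (A : ZMod k → Option V) (iP iQ : ZMod k) (vP vQ : V) (hne : iP ≠ iQ) :
    Function.update (Function.update A iP (some vP)) iQ (some vQ) =
      Function.update (Function.update A iQ (some vQ)) iP (some vP) ∧
    ((Function.update A iP (some vP)) (iP + 1) =
        (Function.update (Function.update A iQ (some vQ)) iP (some vP)) (iP + 1) ∨
      (Function.update A iQ (some vQ)) (iQ + 1) =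
        (Function.update (Function.update A iP (some vP)) iQ (some vQ)) (iQ + 1)) := by
  refine ⟨Function.update_comm hne _ _ A, ?_⟩
  by_cases h : iP + 1 = iQ
  · right
    have h_two : (2 : ZMod k) ≠ 0 := fun h0 => by
      have h_dvd : k ∣ 2 := (ZMod.natCast_eq_zero_iff 2 k).mp (by exact_mod_cast h0)
      exact absurd (Nat.le_of_dvd two_pos h_dvd) (by omega)
    have h' : iQ + 1 ≠ iP := fun h1 => h_two (by linear_combination h + h1)
    rw [Function.update_comm hne, Function.update_of_ne h']
  · left
    rw [Function.update_comm hne.symm, Function.update_of_ne h]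
end

section
/- In a sequential execution of the WRN_k set-consensus algorithm given by an order σ, the response of process P_i equals some (v (i + 1)) if process P_{i+1} took its step before P_i (i.e., σ⁻¹ (i + 1) < σ⁻¹ i as elements of Fin k), and equals none otherwise. Formally: for every i : ZMod k, r i = some (v (i + 1)) if σ⁻¹ (i + 1) < σ⁻¹ i, and r i = none if σ⁻¹ i < σ⁻¹ (i + 1). -/
/-- After `t` steps, the cells written are exactly those of the processes scheduled
before time `t`, and each holds the proposal of its process. -/
theorem state_eq_ite {ι V : Type*} [DecidableEq ι] {k : ℕ} (v : ι → V) (σ : Fin k ≃ ι)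
    (A : ℕ → ι → Option V) (hA0 : A 0 = fun _ => none)
    (hAsucc : ∀ t : Fin k, A (t.val + 1) = Function.update (A t.val) (σ t) (some (v (σ t))))
    (t : ℕ) (ht : t ≤ k) (j : ι) :
    A t j = if (σ.symm j).val < t then some (v j) else none := by
  induction t with
  | zero => simp [hA0]
  | succ t ih =>
    rw [hAsucc ⟨t, ht⟩]
    by_cases h : j = σ ⟨t, ht⟩
    · subst h
      simp
    · have hne : (σ.symm j).val ≠ t := fun e => h (σ.symm_apply_eq.1 (Fin.ext e))
      have hlt : (σ.symm j).val < t + 1 ↔ (σ.symm j).val < t := by omega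
      simp only [Function.update_of_ne h, ih (Nat.le_of_succ_le ht), hlt]


/-- In a sequential execution of the WRN_k set-consensus algorithm, the response of
process `P_i` is `some (v (i+1))` if `P_{i+1}` stepped before `P_i`, and `none`
otherwise. -/
theorem wrn_response_characterization (k : ℕ) (hk : 3 ≤ k) (V : Type*) (v : ZMod k → V) (σ : Fin k ≃ ZMod k)
    (A : ℕ → ZMod k → Option V)
    (hA0 : A 0 = fun _ => none)
    (hAsucc : ∀ t : Fin k, A (t.val + 1) = Function.update (A t.val) (σ t) (some (v (σ t))))
    (r : ZMod k → Option V)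
    (hr : ∀ i : ZMod k, r i = A ((σ.symm i).val + 1) (i + 1))
    (d : ZMod k → V)
    (hd : ∀ i : ZMod k, d i = (r i).getD (v i)) :
    ∀ i : ZMod k,
      (σ.symm (i + 1) < σ.symm i → r i = some (v (i + 1))) ∧
      (σ.symm i < σ.symm (i + 1) → r i = none) := by
  have key (i j : ZMod k) := state_eq_ite v σ A hA0 hAsucc ((σ.symm i).val + 1) (σ.symm i).isLt j
  intro i
  rw [hr, key]
  exact ⟨fun h => if_pos (Nat.lt_succ_of_lt h), fun h => if_neg (Nat.not_lt.2 h)⟩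
end

section
/- In any sequential execution of the WRN_k set-consensus algorithm, the last process to perform its WRN operation decides the proposed value of its cyclic successor. Formally: if j = σ ⟨k-1, _⟩ is the process taking the last step, then d j = v (j + 1). -/
/-- After `n` steps, every process that has already taken its step has its value stored. -/
theorem wrn_state_apply_of_lt {k : ℕ} {ι V : Type*} [DecidableEq ι] {v : ι → V} {σ : Fin k ≃ ι}
    {A : ℕ → ι → Option V}
    (hA : ∀ t : Fin k, A (t.val + 1) = Function.update (A t.val) (σ t) (some (v (σ t))))
    {n : ℕ} (hn : n ≤ k) {i : ι} (hi : (σ.symm i).val < n) : A n i = some (v i) := by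
  induction n with
  | zero => omega
  | succ n ih =>
    rw [hA ⟨n, hn⟩]
    by_cases h : i = σ ⟨n, hn⟩
    · subst h
      simp
    · rw [Function.update_of_ne h]
      have hne : (σ.symm i).val ≠ n := fun h' =>
        h (σ.symm_apply_eq.mp (Fin.ext h'))
      exact ih (by omega) (by omega)

/-- The last process to perform its WRN operation decides the proposed value of its
cyclic successor. -/
theorem wrn_last_decides_successor (k : ℕ) (hk : 3 ≤ k) (V : Type*) (v : ZMod k → V) (σ : Fin k ≃ ZMod k)
    (A : ℕ → ZMod k → Option V)
    (hA0 : A 0 = fun _ => none)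
    (hAsucc : ∀ t : Fin k, A (t.val + 1) = Function.update (A t.val) (σ t) (some (v (σ t))))
    (r : ZMod k → Option V)
    (hr : ∀ i : ZMod k, r i = A ((σ.symm i).val + 1) (i + 1))
    (d : ZMod k → V)
    (hd : ∀ i : ZMod k, d i = (r i).getD (v i)) :
    ∀ j : ZMod k, j = σ ⟨k - 1, by omega⟩ → d j = v (j + 1) := by
  rintro j rfl
  have hlt := (σ.symm (σ ⟨k - 1, by omega⟩ + 1)).isLt
  rw [hd, hr, σ.symm_apply_apply,
    wrn_state_apply_of_lt hAsucc (by dsimp only; omega) (by dsimp only; omega), Option.getD_some]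
end

section
/- Validity of the WRN_k set-consensus algorithm: in any sequential execution, every process decides either its own proposed value or the proposed value of its cyclic successor. Formally: for every i : ZMod k, d i = v i or d i = v (i + 1). In particular every decided value is the proposal of some process. -/
/-- Validity: every process decides either its own proposed value or the proposed
value of its cyclic successor. -/
theorem wrn_validity (k : ℕ) (hk : 3 ≤ k) (V : Type*) (v : ZMod k → V) (σ : Fin k ≃ ZMod k)
    (A : ℕ → ZMod k → Option V)
    (hA0 : A 0 = fun _ => none)
    (hAsucc : ∀ t : Fin k, A (t.val + 1) = Function.update (A t.val) (σ t) (some (v (σ t))))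
    (r : ZMod k → Option V)
    (hr : ∀ i : ZMod k, r i = A ((σ.symm i).val + 1) (i + 1))
    (d : ZMod k → V)
    (hd : ∀ i : ZMod k, d i = (r i).getD (v i)) :
    ∀ i : ZMod k, d i = v i ∨ d i = v (i + 1) := by
  have state_eq : ∀ t : ℕ, t ≤ k → ∀ j, A t j = none ∨ A t j = some (v j) := by
    intro t
    induction t with
    | zero => simp [hA0]
    | succ t ih =>
      intro ht j
      rw [hAsucc ⟨t, ht⟩]
      by_cases hj : j = σ ⟨t, ht⟩
      · simp [hj]
      · simpa [Function.update_of_ne hj] using ih (Nat.le_of_succ_le ht) j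
  intro i
  rw [hd, hr]
  rcases state_eq _ (σ.symm i).isLt (i + 1) with h | h <;> simp [h]
end

section
/- In any sequential execution of the WRN_k set-consensus algorithm with pairwise distinct proposals, no process decides the proposed value of the process that takes the last step. Formally: if v : ZMod k → V is injective and j = σ ⟨k-1, _⟩ is the process taking the last step, then for every i : ZMod k, d i ≠ v j. -/
/-- After `t` steps the state holds exactly the values of the processes that have moved. -/
theorem wrn_state_apply {k : ℕ} {ι V : Type*} [DecidableEq ι] (v : ι → V) (σ : Fin k ≃ ι)
    (A : ℕ → ι → Option V) (hA0 : A 0 = fun _ => none)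
    (hAsucc : ∀ t : Fin k,
      A (t.val + 1) = Function.update (A t.val) (σ t) (some (v (σ t))))
    {t : ℕ} (ht : t ≤ k) (j : ι) :
    A t j = if (σ.symm j).val < t then some (v j) else none := by
  induction t with
  | zero => simp [hA0]
  | succ t ih =>
    rw [hAsucc ⟨t, ht⟩]
    by_cases hj : j = σ ⟨t, ht⟩
    · simp [hj]
    · have hne : (σ.symm j).val ≠ t := fun h =>
        hj (σ.symm_apply_eq.mp (Fin.ext h))
      rw [Function.update_of_ne hj, ih (by omega)]
      exact if_congr (by omega) rfl rfl

/-- With pairwise distinct proposals, no process decides the proposed value of the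
process taking the last step. -/
theorem wrn_last_value_not_decided (k : ℕ) (hk : 3 ≤ k) (V : Type*) (v : ZMod k → V) (σ : Fin k ≃ ZMod k)
    (A : ℕ → ZMod k → Option V)
    (hA0 : A 0 = fun _ => none)
    (hAsucc : ∀ t : Fin k, A (t.val + 1) = Function.update (A t.val) (σ t) (some (v (σ t))))
    (r : ZMod k → Option V)
    (hr : ∀ i : ZMod k, r i = A ((σ.symm i).val + 1) (i + 1))
    (d : ZMod k → V)
    (hd : ∀ i : ZMod k, d i = (r i).getD (v i))
    (hv : Function.Injective v) :
    ∀ i : ZMod k, d i ≠ v (σ ⟨k - 1, by omega⟩) := by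
  intro i h
  have : Fact (1 < k) := ⟨by omega⟩
  rw [hd, hr, wrn_state_apply v σ A hA0 hAsucc (σ.symm i).isLt] at h
  split_ifs at h with hlt
  · have hlast : σ.symm (i + 1) = ⟨k - 1, by omega⟩ := σ.symm_apply_eq.mpr (hv h)
    have hi : σ.symm i = σ.symm (i + 1) := by
      ext
      rw [hlast] at hlt ⊢
      have := (σ.symm i).isLt
      dsimp only at hlt ⊢
      omega
    simpa using σ.symm.injective hi
  · have hlast : σ.symm i = ⟨k - 1, by omega⟩ := σ.symm_apply_eq.mpr (hv h)
    rw [hlast] at hlt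
    have := (σ.symm (i + 1)).isLt
    dsimp only at hlt
    omega
end

section
/- (k−1)-agreement of the WRN_k set-consensus algorithm: in any sequential execution with pairwise distinct proposals, at most k − 1 different values are decided. Formally: if v : ZMod k → V is injective, then the cardinality of the image of the decision function d over all k processes satisfies (Finset.univ.image d).card ≤ k − 1. -/
/-- (k−1)-agreement: with pairwise distinct proposals, at most `k − 1` different
values are decided. -/
theorem wrn_set_agreement (k : ℕ) (hk : 3 ≤ k) (V : Type*) (v : ZMod k → V) (σ : Fin k ≃ ZMod k)
    (A : ℕ → ZMod k → Option V)
    (hA0 : A 0 = fun _ => none)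
    (hAsucc : ∀ t : Fin k, A (t.val + 1) = Function.update (A t.val) (σ t) (some (v (σ t))))
    (r : ZMod k → Option V)
    (hr : ∀ i : ZMod k, r i = A ((σ.symm i).val + 1) (i + 1))
    (d : ZMod k → V)
    (hd : ∀ i : ZMod k, d i = (r i).getD (v i))
    [DecidableEq V] [NeZero k]
    (hv : Function.Injective v) :
    (Finset.univ.image d).card ≤ k - 1 := by
  have : Fact (1 < k) := ⟨by omega⟩
  set p : ZMod k := σ 0 with hp
  have stored : ∀ t, t + 1 ≤ k → A (t + 1) p = some (v p) := by
    intro t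
    induction t with
    | zero =>
      intro _
      have h := hAsucc 0
      rw [Fin.val_zero, ← hp] at h
      rw [h, Function.update_self]
    | succ t ih =>
      intro ht
      have h := hAsucc ⟨t + 1, ht⟩
      simp only at h
      have hne : p ≠ σ ⟨t + 1, ht⟩ := by
        rw [hp, σ.injective.ne_iff, Ne, Fin.ext_iff, Fin.val_zero]
        simp
      rw [h, Function.update_of_ne hne, ih (by omega)]
  have first_decision : d p = v p := by
    have h := hAsucc 0
    rw [Fin.val_zero, ← hp, hA0] at h
    have hne : p + 1 ≠ p := by simp
    rw [hd, hr, hp, σ.symm_apply_apply, Fin.val_zero, ← hp, h, Function.update_of_ne hne,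
      Option.getD_none]
  have pred_decision : d (p - 1) = v p := by
    rw [hd, hr, sub_add_cancel, stored _ (σ.symm (p - 1)).isLt, Option.getD_some]
  have d_not_injective : ¬ Function.Injective d := fun h => by
    simpa using h (pred_decision.trans first_decision.symm)
  have hlt : (Finset.univ.image d).card < k := by
    refine lt_of_le_of_ne (Finset.card_image_le.trans_eq (ZMod.card k)) fun h => d_not_injective ?_
    rw [← Set.injOn_univ, ← Finset.coe_univ, ← Finset.card_image_iff, h, Finset.card_univ,
      ZMod.card]
  omega
end

section
/- The WRN_k set-consensus algorithm solves the (k, k−1)-set consensus task for k processes in every sequential execution: (1) validity: for every i : ZMod k, the decision d i is the proposal of some process, i.e., d i ∈ Set.range v; and (2) (k−1)-agreement: if the proposals v : ZMod k → V are pairwise distinct (v injective), then at most k − 1 different values are decided, i.e., (Finset.univ.image d).card ≤ k − 1. -/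
/-- The WRN_k algorithm solves (k, k−1)-set consensus: validity and
(k−1)-agreement. -/
theorem wrn_solves_set_consensus (k : ℕ) (hk : 3 ≤ k) (V : Type*) (v : ZMod k → V) (σ : Fin k ≃ ZMod k)
    (A : ℕ → ZMod k → Option V)
    (hA0 : A 0 = fun _ => none)
    (hAsucc : ∀ t : Fin k, A (t.val + 1) = Function.update (A t.val) (σ t) (some (v (σ t))))
    (r : ZMod k → Option V)
    (hr : ∀ i : ZMod k, r i = A ((σ.symm i).val + 1) (i + 1))
    (d : ZMod k → V)
    (hd : ∀ i : ZMod k, d i = (r i).getD (v i))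
    [DecidableEq V] [NeZero k] :
    (∀ i : ZMod k, d i ∈ Set.range v) ∧
    (Function.Injective v → (Finset.univ.image d).card ≤ k - 1) := by
  have hdec (i : ZMod k) : d i = if σ.symm (i + 1) ≤ σ.symm i then v (i + 1) else v i := by
    rw [hd, hr, wrn_state_apply v σ A hA0 hAsucc (σ.symm i).isLt]
    simp only [Nat.lt_succ_iff, Fin.le_def]
    split_ifs <;> rfl
  refine ⟨fun i => ?_, fun hv => ?_⟩
  · rw [hdec]
    split_ifs <;> exact Set.mem_range_self _
  -- The proposal of the last scheduled process is never decided.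
  obtain ⟨l, hl⟩ : ∃ l, ∀ i, σ.symm i ≤ σ.symm l := Finite.exists_max σ.symm
  have : Fact (1 < k) := ⟨by omega⟩
  have hnot (i : ZMod k) : d i ≠ v l := by
    rw [hdec]
    split_ifs with h <;> intro heq
    · have hi : i + 1 = l := hv heq
      rw [hi] at h
      have : i = l := σ.symm.injective ((hl i).antisymm h)
      simp [this] at hi
    · rw [hv heq] at h
      exact h (hl _)
  have hsub : Finset.univ.image d ⊆ (Finset.univ.erase l).image v := by
    intro x hx
    obtain ⟨i, -, rfl⟩ := Finset.mem_image.1 hx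
    have hi := hnot i
    rw [hdec] at hi ⊢
    split_ifs at hi ⊢ <;>
      exact Finset.mem_image_of_mem v (Finset.mem_erase.2 ⟨ne_of_apply_ne v hi, Finset.mem_univ _⟩)
  calc (Finset.univ.image d).card ≤ ((Finset.univ.erase l).image v).card := Finset.card_le_card hsub
    _ ≤ (Finset.univ.erase l).card := Finset.card_image_le
    _ = k - 1 := by rw [Finset.card_erase_of_mem (Finset.mem_univ l), Finset.card_univ, ZMod.card]
end

section
/- A WRN_2 object solves consensus for two processes: in any sequential execution of the two-process algorithm, both processes decide the proposed value of the process that took the first step. Formally: for every bijection σ : Fin 2 ≃ ZMod 2 and all proposals v : ZMod 2 → V, we have d 0 = v (σ 0) and d 1 = v (σ 0); in particular d 0 = d 1 (agreement) and the common decision lies in Set.range v (validity). -/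
/-- A WRN_2 object solves consensus for two processes: both processes decide the
proposed value of the process taking the first step. -/
theorem wrn2_solves_consensus (V : Type*) (v : ZMod 2 → V) (σ : Fin 2 ≃ ZMod 2)
    (A : ℕ → ZMod 2 → Option V)
    (hA0 : A 0 = fun _ => none)
    (hAsucc : ∀ t : Fin 2, A (t.val + 1) = Function.update (A t.val) (σ t) (some (v (σ t))))
    (r : ZMod 2 → Option V)
    (hr : ∀ i : ZMod 2, r i = A ((σ.symm i).val + 1) (i + 1))
    (d : ZMod 2 → V)
    (hd : ∀ i : ZMod 2, d i = (r i).getD (v i)) :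
    d 0 = v (σ 0) ∧ d 1 = v (σ 0) ∧ d 0 = d 1 ∧ d 0 ∈ Set.range v := by
  have eq_add_one : ∀ a b : ZMod 2, a ≠ b → a + 1 = b := by decide
  have hne : σ 0 ≠ σ 1 := σ.injective.ne (by decide)
  have hA1 : A 1 = Function.update (fun _ => none) (σ 0) (some (v (σ 0))) := by
    simpa [hA0] using hAsucc 0
  have hA2 : A 2 = Function.update (A 1) (σ 1) (some (v (σ 1))) := by
    simpa using hAsucc 1
  have d_first : d (σ 0) = v (σ 0) := by
    simp [hd, hr, eq_add_one _ _ hne, hA1, hne.symm]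
  have d_second : d (σ 1) = v (σ 0) := by
    simp [hd, hr, eq_add_one _ _ hne.symm, hA2, hA1, hne]
  have hall : ∀ i, d i = v (σ 0) := fun i => by
    obtain ⟨t, rfl⟩ := σ.surjective i
    fin_cases t
    exacts [d_first, d_second]
  exact ⟨hall 0, hall 1, (hall 0).trans (hall 1).symm, σ 0, (hall 0).symm⟩
end
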